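/- Let $h(z)=\sum_{n=0}^{\infty}a_n z^n$ and $g(z)=\sum_{n=0}^{\infty}b_n z^n$ be analytic on the unit disk $\mathbb{D}$ with $|g'(z)| \le k|h'(z)|$ for all $z \in \mathbb{D}$, where $k \in (0,1]$. Then for all $0 \le r \le 1/3$, $\sum_{n=1}^{\infty}|b_n| r^n \le k \sum_{n=1}^{\infty}|a_n| r^n$. -/

import Mathlib

open Real Complex in
lemma avgL (f : ℂ → ℂ) (ρ : ℝ) (hρ : 0 < ρ) (hf : DifferentiableOn ℂ f (Metric.closedBall 0 ρ))
    (m : ℕ) (hm : 1 ≤ m) (u v : ℂ) :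
    circleAverage (fun z => f z * (1 + (u * ρ ^ m / z ^ m + v * z ^ m / ρ ^ m) / 2)) 0 ρ
      = f 0 + u * ρ ^ m * (iteratedDeriv m f 0 / m.factorial) / 2 := by
  have hc : ContinuousOn f (Metric.sphere 0 ρ) := hf.continuousOn.mono Metric.sphere_subset_closedBall
  have hz : ∀ z ∈ Metric.sphere (0:ℂ) ρ, z ^ m ≠ 0 := by
    intro z hz
    apply pow_ne_zero
    rintro rfl
    simp at hz
    exact hρ.ne hz
  have hz' : ∀ z ∈ Metric.sphere (0:ℂ) ρ, z ≠ 0 := by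
    rintro z hz rfl
    simp at hz
    exact hρ.ne hz
  have hρc : (ρ:ℂ) ≠ 0 := by exact_mod_cast hρ.ne'
  have c1 : CircleIntegrable (fun z => f z + (v / ρ ^ m / 2) * (z ^ m * f z)) 0 ρ :=
    ContinuousOn.circleIntegrable hρ.le (by fun_prop)
  have c2 : CircleIntegrable (fun z => (u * ρ ^ m / 2) • (f z / z ^ m)) 0 ρ := by
    apply ContinuousOn.circleIntegrable hρ.le
    exact (hc.div (by fun_prop) hz).const_smul (u * ρ ^ m / 2 : ℂ)
  have e1 : circleAverage (fun z => f z + (v / ρ ^ m / 2) * (z ^ m * f z)) 0 ρ = f 0 := by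
    rw [circleAverage_of_differentiable_on_off_countable (s := ∅) Set.countable_empty]
    · simp [show m ≠ 0 by omega]
    · rw [abs_of_pos hρ]
      have := hf.continuousOn
      fun_prop
    · rw [abs_of_pos hρ]
      intro z hz
      have : DifferentiableAt ℂ f z := hf.differentiableAt (Metric.closedBall_mem_nhds_of_mem hz.1)
      fun_prop
  have e2 : circleAverage (fun z => (f z / z ^ m)) 0 ρ = iteratedDeriv m f 0 / m.factorial := by
    rw [circleAverage_eq_circleIntegral hρ.ne']
    have := hf.circleIntegral_one_div_sub_center_pow_smul hρ m
    have h3 : (∮ z in C(0, ρ), (z - 0)⁻¹ • (f z / z ^ m)) = ∮ z in C(0, ρ), (1 / (z - 0) ^ (m + 1)) • f z := by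
      apply circleIntegral.integral_congr hρ.le
      intro z hzz
      have := hz' z hzz
      simp only [sub_zero, smul_eq_mul]
      field_simp
      ring
    rw [h3, this]
    have := Real.pi_ne_zero
    have : (m.factorial : ℂ) ≠ 0 := by exact_mod_cast m.factorial_ne_zero
    simp only [smul_eq_mul]
    field_simp
  rw [circleAverage_congr_sphere (f₂ := (fun z => f z + (v / ρ ^ m / 2) * (z ^ m * f z)) + fun z => (u * ρ ^ m / 2) • (f z / z ^ m))]
  · rw [circleAverage_add c1 c2, e1, circleAverage_fun_smul, e2, smul_eq_mul]
    ring
  · rw [abs_of_pos hρ]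
    intro z hzz
    have := hz' z hzz
    simp only [Pi.add_apply, smul_eq_mul]
    field_simp
    ring

open Real Complex in
lemma coefBound (f : ℂ → ℂ) (k : ℝ) (ρ : ℝ) (hρ : 0 < ρ)
    (hf : DifferentiableOn ℂ f (Metric.closedBall 0 ρ))
    (hk : ∀ z ∈ Metric.closedBall (0:ℂ) ρ, ‖f z‖ ≤ k)
    (m : ℕ) (hm : 1 ≤ m) :
    ‖f 0‖ + ρ ^ m * ‖iteratedDeriv m f 0 / m.factorial‖ / 2 ≤ k := by
  set c := iteratedDeriv m f 0 / m.factorial with hcdef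
  obtain ⟨u, hu, hu'⟩ : ∃ u : ℂ, ‖u‖ = 1 ∧ ‖f 0 + u * ρ ^ m * c / 2‖ = ‖f 0‖ + ρ ^ m * ‖c‖ / 2 := by
    refine ⟨exp ((arg (f 0) - arg c : ℝ) * I), norm_exp_ofReal_mul_I _, ?_⟩
    have h1 := norm_mul_exp_arg_mul_I (f 0)
    have h2 := norm_mul_exp_arg_mul_I c
    have h3 : exp ((arg (f 0) - arg c : ℝ) * I) * exp (arg c * I) = exp (arg (f 0) * I) := by
      rw [← Complex.exp_add]; congr 1; push_cast; ring
    have : f 0 + exp ((arg (f 0) - arg c : ℝ) * I) * ρ ^ m * c / 2 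
        = ((‖f 0‖ + ρ ^ m * ‖c‖ / 2 : ℝ) : ℂ) * exp (arg (f 0) * I) := by
      push_cast at h3 ⊢
      linear_combination (-1 : ℂ) * h1 - (cexp ((arg (f 0) - arg c) * I) * ρ ^ m / 2) * h2
        + (ρ ^ m * ‖c‖ / 2 : ℂ) * h3
    rw [this, norm_mul, norm_exp_ofReal_mul_I, mul_one, Complex.norm_real, Real.norm_of_nonneg]
    positivity
  rw [← hu']
  set K : ℂ → ℂ := fun z => 1 + (u * ρ ^ m / z ^ m + (starRingEnd ℂ u) * z ^ m / ρ ^ m) / 2 with hK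
  have A1 := avgL f ρ hρ hf m hm u (starRingEnd ℂ u)
  have A2 := avgL (fun _ => 1) ρ hρ (by fun_prop) m hm u (starRingEnd ℂ u)
  have hm0 : m ≠ 0 := by omega
  simp [iteratedDeriv_const, hm0] at A2
  rw [← hcdef] at A1
  change circleAverage (fun z => f z * K z) 0 ρ = _ at A1
  change circleAverage K 0 ρ = _ at A2
  have hz' : ∀ z ∈ Metric.sphere (0:ℂ) ρ, z ≠ 0 := by
    rintro z hz rfl
    simp at hz
    exact hρ.ne hz
  have hρc : (ρ:ℂ) ≠ 0 := by exact_mod_cast hρ.ne'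
  have hKc : ContinuousOn K (Metric.sphere 0 ρ) := by
    have : ∀ z ∈ Metric.sphere (0:ℂ) ρ, z ^ m ≠ 0 := fun z hz => pow_ne_zero _ (hz' z hz)
    have h2 : ContinuousOn (fun z : ℂ => u * ρ ^ m / z ^ m) (Metric.sphere 0 ρ) :=
      ContinuousOn.div (by fun_prop) (by fun_prop) this
    fun_prop
  have hc : ContinuousOn f (Metric.sphere 0 ρ) := hf.continuousOn.mono Metric.sphere_subset_closedBall
  have hKn : ∀ z ∈ Metric.sphere (0:ℂ) ρ, ‖K z‖ = (K z).re := by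
    intro z hz
    have hz0 := hz' z hz
    set q := u * ρ ^ m / z ^ m with hq
    have hzn : ‖z‖ = ρ := by simpa using hz
    have hzz : starRingEnd ℂ z = ρ ^ 2 / z := by
      rw [eq_div_iff hz0, ← Complex.normSq_eq_conj_mul_self, Complex.normSq_eq_norm_sq, hzn]
      push_cast; rfl
    have hqc : starRingEnd ℂ q = (starRingEnd ℂ u) * z ^ m / ρ ^ m := by
      rw [hq, map_div₀, map_mul, map_pow, map_pow, hzz, Complex.conj_ofReal, div_pow]
      field_simp
      ring
    have hqn : ‖q‖ = 1 := by
      rw [hq, norm_div, norm_mul, norm_pow, norm_pow, hu, hzn, Complex.norm_real, Real.norm_of_nonneg hρ.le]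
      field_simp
    have : K z = ((1 + q.re : ℝ) : ℂ) := by
      simp only [hK]
      rw [← hq, ← hqc, Complex.add_conj]
      push_cast; ring
    rw [this, Complex.norm_real, Complex.ofReal_re, Real.norm_of_nonneg]
    have := Complex.abs_re_le_norm q
    rw [hqn] at this
    linarith [(abs_le.1 this).1]
  have iK : CircleIntegrable K 0 ρ := hKc.circleIntegrable hρ.le
  rw [← A1]
  calc ‖circleAverage (fun z => f z * K z) 0 ρ‖ ≤ circleAverage (fun z => ‖f z * K z‖) 0 ρ := by
        rw [circleAverage_def, circleAverage_def, norm_smul, smul_eq_mul, Real.norm_of_nonneg (by positivity)]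
        gcongr
        exact intervalIntegral.norm_integral_le_integral_norm (by positivity)
    _ ≤ circleAverage (fun z => k • (K z).re) 0 ρ := by
        apply circleAverage_mono
        · exact (hc.mul hKc).norm.circleIntegrable hρ.le
        · exact ContinuousOn.circleIntegrable hρ.le ((Complex.continuous_re.comp_continuousOn hKc).const_smul k)
        · rw [abs_of_pos hρ]
          intro z hz
          rw [norm_mul, hKn z hz, smul_eq_mul]
          have : 0 ≤ (K z).re := by rw [← hKn z hz]; positivity
          exact mul_le_mul_of_nonneg_right (hk z (Metric.sphere_subset_closedBall hz)) this
    _ = k := by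
        rw [circleAverage_fun_smul]
        have := Complex.reCLM.circleAverage_comp_comm iK
        rw [A2] at this
        have h2 : circleAverage (fun z => (K z).re) 0 ρ = 1 := by
          simpa [Function.comp_def] using this
        rw [h2]; simp

lemma quot (H G : ℂ → ℂ) (k : ℝ) (hk : 0 < k) (hH : AnalyticOnNhd ℂ H (Metric.ball 0 1))
    (hG : AnalyticOnNhd ℂ G (Metric.ball 0 1))
    (hle : ∀ z ∈ Metric.ball (0:ℂ) 1, ‖G z‖ ≤ k * ‖H z‖) :
    ∃ w : ℂ → ℂ, AnalyticOnNhd ℂ w (Metric.ball 0 1) ∧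
      (∀ z ∈ Metric.ball (0:ℂ) 1, ‖w z‖ ≤ k) ∧
      ∀ z ∈ Metric.ball (0:ℂ) 1, G z = w z * H z := by
  by_cases h0 : Set.EqOn H 0 (Metric.ball 0 1)
  · refine ⟨fun _ => 0, fun _ _ => analyticAt_const, fun _ _ => by rw [norm_zero]; exact hk.le, ?_⟩
    intro z hz
    have := hle z hz
    rw [h0 hz] at this
    simpa using this
  have hne : ∀ z ∈ Metric.ball (0:ℂ) 1, ∀ᶠ y in nhdsWithin z {z}ᶜ, H y ≠ 0 := by
    intro z hz
    by_contra hcon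
    exact h0 (hH.eqOn_zero_of_preconnected_of_frequently_eq_zero
      (convex_ball (0:ℂ) 1).isPreconnected hz hcon)
  have hmer : MeromorphicOn (G / H) (Metric.ball 0 1) :=
    fun z hz => (hG z hz).meromorphicAt.div (hH z hz).meromorphicAt
  set w := toMeromorphicNFOn (G / H) (Metric.ball 0 1) with hw
  have hev : ∀ z ∈ Metric.ball (0:ℂ) 1, ∀ᶠ y in nhdsWithin z {z}ᶜ, ‖w y‖ ≤ k ∧ G y = w y * H y := by
    intro z hz
    filter_upwards [hmer.toMeromorphicNFOn_eq_self_on_nhdsNE hz, hne z hz,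
      mem_nhdsWithin_of_mem_nhds (Metric.isOpen_ball.mem_nhds hz)] with y h1 h2 h3
    rw [hw, h1, Pi.div_apply, norm_div]
    refine ⟨?_, by field_simp⟩
    rw [div_le_iff₀ (norm_pos_iff.2 h2)]
    exact hle y h3
  have han : AnalyticOnNhd ℂ w (Metric.ball 0 1) := by
    intro z hz
    have hnf := meromorphicNFOn_toMeromorphicNFOn (G / H) (Metric.ball 0 1) hz
    rw [← hw] at hnf
    rw [← hnf.meromorphicOrderAt_nonneg_iff_analyticAt]
    by_contra hcon
    have ht := (tendsto_cobounded_iff_meromorphicOrderAt_neg hnf.meromorphicAt).2 (not_le.1 hcon)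
    have h3 := (tendsto_norm_cobounded_atTop.comp ht).eventually (Filter.eventually_gt_atTop k)
    obtain ⟨y, hy1, hy2⟩ := (h3.and (hev z hz)).exists
    exact absurd hy2.1 (not_le.2 hy1)
  refine ⟨w, han, ?_, ?_⟩
  · intro z hz
    have : Filter.Tendsto (fun y => ‖w y‖) (nhdsWithin z {z}ᶜ) (nhds ‖w z‖) :=
      ((han z hz).continuousAt.norm).tendsto.mono_left nhdsWithin_le_nhds
    exact le_of_tendsto this ((hev z hz).mono fun y hy => hy.1)
  · intro z hz
    have h1 : Filter.Tendsto G (nhdsWithin z {z}ᶜ) (nhds (G z)) :=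
      ((hG z hz).continuousAt).tendsto.mono_left nhdsWithin_le_nhds
    have h2 : Filter.Tendsto (fun y => w y * H y) (nhdsWithin z {z}ᶜ) (nhds (w z * H z)) :=
      (((han z hz).continuousAt.mul (hH z hz).continuousAt)).tendsto.mono_left nhdsWithin_le_nhds
    exact tendsto_nhds_unique (h1.congr' ((hev z hz).mono fun y hy => hy.2)) h2

lemma coefEq (h : ℂ → ℂ) (a : ℕ → ℂ) (hha : AnalyticAt ℂ h 0)
    (hs : ∀ z ∈ Metric.ball (0:ℂ) 1, HasSum (fun n : ℕ => a n * z ^ n) (h z)) (n : ℕ) :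
    iteratedDeriv n h 0 = n.factorial * a n := by
  have h1 : HasFPowerSeriesAt h (FormalMultilinearSeries.ofScalars ℂ a) 0 := by
    rw [hasFPowerSeriesAt_iff]
    filter_upwards [Metric.ball_mem_nhds (0:ℂ) one_pos] with z hz
    simpa [FormalMultilinearSeries.coeff_ofScalars, mul_comm] using hs z hz
  have h2 := h1.eq_formalMultilinearSeries hha.hasFPowerSeriesAt
  have h3 := congrArg (fun p => FormalMultilinearSeries.coeff p n) h2
  simp only [FormalMultilinearSeries.coeff_ofScalars] at h3
  rw [h3]
  have : (n.factorial : ℂ) ≠ 0 := by exact_mod_cast n.factorial_ne_zero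
  field_simp

lemma coefBound' (f : ℂ → ℂ) (k : ℝ) (hf : AnalyticOnNhd ℂ f (Metric.ball 0 1))
    (hk : ∀ z ∈ Metric.ball (0:ℂ) 1, ‖f z‖ ≤ k) (m : ℕ) (hm : 1 ≤ m) :
    ‖iteratedDeriv m f 0 / m.factorial‖ ≤ 2 * (k - ‖f 0‖) := by
  set c := ‖iteratedDeriv m f 0 / m.factorial‖ with hc
  have key : ∀ᶠ ρ : ℝ in nhdsWithin 1 (Set.Iio 1), ‖f 0‖ + ρ ^ m * c / 2 ≤ k := by
    filter_upwards [Ioo_mem_nhdsLT (show (0:ℝ) < 1 by norm_num)] with ρ hρ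
    have hsub : Metric.closedBall (0:ℂ) ρ ⊆ Metric.ball 0 1 := Metric.closedBall_subset_ball hρ.2
    exact coefBound f k ρ hρ.1 (hf.differentiableOn.mono hsub) (fun z hz => hk z (hsub hz)) m hm
  have ht : Filter.Tendsto (fun ρ : ℝ => ‖f 0‖ + ρ ^ m * c / 2) (nhdsWithin 1 (Set.Iio 1))
      (nhds (‖f 0‖ + 1 ^ m * c / 2)) :=
    (Continuous.tendsto (by fun_prop) 1).mono_left nhdsWithin_le_nhds
  have := le_of_tendsto ht key
  rw [one_pow] at this
  linarith

theorem stmt3 (h g : ℂ → ℂ) (a b : ℕ → ℂ) (k : ℝ) (hk : k ∈ Set.Ioc (0:ℝ) 1)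
    (hha : AnalyticOn ℂ h (Metric.ball (0:ℂ) 1))
    (hga : AnalyticOn ℂ g (Metric.ball (0:ℂ) 1))
    (hsum_h : ∀ z ∈ Metric.ball (0:ℂ) 1, HasSum (fun n : ℕ => a n * z ^ n) (h z))
    (hsum_g : ∀ z ∈ Metric.ball (0:ℂ) 1, HasSum (fun n : ℕ => b n * z ^ n) (g z))
    (hderiv : ∀ z ∈ Metric.ball (0:ℂ) 1, ‖deriv g z‖ ≤ k * ‖deriv h z‖) :
    ∀ r : ℝ, 0 ≤ r → r ≤ 1 / 3 →
      ∑' n : ℕ, ‖b (n + 1)‖ * r ^ (n + 1) ≤ k * ∑' n : ℕ, ‖a (n + 1)‖ * r ^ (n + 1) := by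
  intro r hr0 hr
  have h0 : (0:ℂ) ∈ Metric.ball (0:ℂ) 1 := by simp
  have hH := (Metric.isOpen_ball.analyticOn_iff_analyticOnNhd.1 hha)
  have hG := (Metric.isOpen_ball.analyticOn_iff_analyticOnNhd.1 hga)
  obtain ⟨w, hwa, hwk, hwe⟩ := quot (deriv h) (deriv g) k hk.1 hH.deriv hG.deriv hderiv
  set c : ℕ → ℂ := fun n => iteratedDeriv n w 0 / n.factorial with hcdef
  have hconv : ∀ n : ℕ, ((n : ℂ) + 1) * b (n + 1)
      = ∑ p ∈ Finset.HasAntidiagonal.antidiagonal n, c p.1 * (((p.2 : ℂ) + 1) * a (p.2 + 1)) := by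
    intro n
    have e1 : deriv g =ᶠ[nhds 0] w * deriv h := by
      filter_upwards [Metric.ball_mem_nhds (0:ℂ) one_pos] with z hz
      exact hwe z hz
    have e2 := e1.iteratedDeriv_eq n
    rw [iteratedDeriv_mul (hwa 0 h0).contDiffAt (hH.deriv 0 h0).contDiffAt, ← iteratedDeriv_succ',
      coefEq g b (hG 0 h0) hsum_g] at e2
    have hn : (n.factorial : ℂ) ≠ 0 := by exact_mod_cast n.factorial_ne_zero
    rw [Finset.Nat.sum_antidiagonal_eq_sum_range_succ_mk]
    apply mul_left_cancel₀ hn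
    rw [Nat.factorial_succ] at e2
    push_cast at e2
    rw [← mul_assoc, mul_comm (n.factorial : ℂ), e2, Finset.mul_sum]
    apply Finset.sum_congr rfl
    intro i hi
    have hin : i ≤ n := by simpa [Nat.lt_succ_iff] using hi
    rw [← iteratedDeriv_succ', coefEq h a (hH 0 h0) hsum_h, ← Nat.choose_mul_factorial_mul_factorial hin,
      Nat.factorial_succ]
    have : (i.factorial : ℂ) ≠ 0 := by exact_mod_cast i.factorial_ne_zero
    simp only [hcdef]
    push_cast
    field_simp
  have hrb : (r : ℂ) ∈ Metric.ball (0:ℂ) 1 := by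
    simp [abs_of_nonneg hr0]; linarith
  have hnr : ‖(r:ℂ)‖ = r := by simp [abs_of_nonneg hr0]
  have sA : Summable (fun n => ‖a (n + 1)‖ * r ^ (n + 1)) := by
    have := (hsum_h r hrb).summable.norm
    simp only [norm_mul, norm_pow, hnr] at this
    exact (summable_nat_add_iff 1).2 this
  have hc1 : ∀ n, ‖c (n + 1)‖ ≤ 2 * (k - ‖c 0‖) := by
    intro n
    have := coefBound' w k hwa hwk (n + 1) (by omega)
    simpa [hcdef] using this
  have hc0 : ‖c 0‖ ≤ k := by simpa [hcdef] using hwk 0 h0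
  have hgeo : HasSum (fun n : ℕ => 2 * (k - ‖c 0‖) * r * r ^ n) (2 * (k - ‖c 0‖) * r * (1 - r)⁻¹) :=
    (hasSum_geometric_of_lt_one hr0 (by linarith)).mul_left _
  have hcle : ∀ n, ‖c (n + 1)‖ * r ^ (n + 1) ≤ 2 * (k - ‖c 0‖) * r * r ^ n := by
    intro n
    have := mul_le_mul_of_nonneg_right (hc1 n) (pow_nonneg hr0 (n + 1))
    calc _ ≤ _ := this
      _ = _ := by ring
  have sC1 : Summable (fun n => ‖c (n + 1)‖ * r ^ (n + 1)) :=
    Summable.of_nonneg_of_le (fun n => by positivity) hcle hgeo.summable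
  have sC : Summable (fun n => ‖c n‖ * r ^ n) := (summable_nat_add_iff 1).1 sC1
  have hC : ∑' n, ‖c n‖ * r ^ n ≤ k := by
    rw [sC.tsum_eq_zero_add]
    have h1 := sC1.tsum_le_tsum hcle hgeo.summable
    rw [hgeo.tsum_eq] at h1
    have h2 : r * (1 - r)⁻¹ ≤ 1 / 2 := by
      rw [← div_eq_mul_inv, div_le_iff₀ (by linarith)]; linarith
    have h3 : 2 * (k - ‖c 0‖) * r * (1 - r)⁻¹ ≤ 2 * (k - ‖c 0‖) * (1 / 2) := by
      rw [mul_assoc]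
      exact mul_le_mul_of_nonneg_left h2 (by linarith)
    simp only [pow_zero, mul_one]
    linarith
  have sCn : Summable (fun n => ‖‖c n‖ * r ^ n‖) := sC.norm
  have sAn : Summable (fun n => ‖‖a (n + 1)‖ * r ^ (n + 1)‖) := sA.norm
  have hprod := tsum_mul_tsum_eq_tsum_sum_antidiagonal_of_summable_norm sCn sAn
  have sP := (summable_norm_sum_mul_antidiagonal_of_summable_norm sCn sAn).of_norm
  have hb : ∀ n, ‖b (n + 1)‖ * r ^ (n + 1) ≤ ∑ p ∈ Finset.HasAntidiagonal.antidiagonal n,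
      (‖c p.1‖ * r ^ p.1) * (‖a (p.2 + 1)‖ * r ^ (p.2 + 1)) := by
    intro n
    have h1 : ((n:ℝ) + 1) * ‖b (n + 1)‖ ≤ ((n:ℝ) + 1) *
        ∑ p ∈ Finset.HasAntidiagonal.antidiagonal n, ‖c p.1‖ * ‖a (p.2 + 1)‖ := by
      have e : ‖((n : ℂ) + 1) * b (n + 1)‖ = ((n:ℝ) + 1) * ‖b (n + 1)‖ := by
        rw [norm_mul]; congr 1; exact_mod_cast Complex.norm_natCast (n + 1)
      rw [← e, hconv, Finset.mul_sum]
      apply norm_sum_le_of_le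
      intro p hp
      have hp' := Finset.HasAntidiagonal.mem_antidiagonal.1 hp
      have e' : ‖(p.2 : ℂ) + 1‖ = (p.2:ℝ) + 1 := by exact_mod_cast Complex.norm_natCast (p.2 + 1)
      rw [norm_mul, norm_mul, e']
      have : (p.2:ℝ) ≤ n := by exact_mod_cast (by omega : p.2 ≤ n)
      calc ‖c p.1‖ * (((p.2:ℝ) + 1) * ‖a (p.2 + 1)‖) = ((p.2:ℝ) + 1) * (‖c p.1‖ * ‖a (p.2 + 1)‖) := by ring
        _ ≤ _ := by gcongr
    have h2 := le_of_mul_le_mul_left h1 (by positivity)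
    calc _ ≤ (∑ p ∈ Finset.HasAntidiagonal.antidiagonal n, ‖c p.1‖ * ‖a (p.2 + 1)‖) * r ^ (n + 1) := by gcongr
      _ = _ := by
        rw [Finset.sum_mul]
        apply Finset.sum_congr rfl
        intro p hp
        rw [← Finset.HasAntidiagonal.mem_antidiagonal.1 hp]
        ring
  have sB := Summable.of_nonneg_of_le (fun n => by positivity) hb sP
  calc _ ≤ _ := sB.tsum_le_tsum hb sP
    _ = _ := hprod.symm
    _ ≤ _ := mul_le_mul_of_nonneg_right hC (tsum_nonneg fun n => by positivity)
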